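/- Let σ and σ̃ be continuously differentiable and positive on an open neighborhood of the closed unit square, let I₀ + I₁ = 0, and let (u, U) and (v, V) be classical CEM solutions for σ and σ̃ respectively, with the same impedances z₀, z₁ > 0 and the same currents I₀, I₁. Assume the interior current magnitudes coincide and are positive: σ|∇u| = σ̃|∇v| > 0 on the closed square. Then the boundary potentials relative to the electrode voltages agree on the electrodes: u(x,0) − U₀ = v(x,0) − V₀ and u(x,1) − U₁ = v(x,1) − V₁ for all x ∈ [0,1]. -/

import Mathlib

open MeasureTheory Set

/-- Partial derivative in the first (x) variable. -/
noncomputable def pdx (u : ℝ × ℝ → ℝ) (p : ℝ × ℝ) : ℝ :=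
  deriv (fun t => u (t, p.2)) p.1

/-- Partial derivative in the second (y) variable. -/
noncomputable def pdy (u : ℝ × ℝ → ℝ) (p : ℝ × ℝ) : ℝ :=
  deriv (fun t => u (p.1, t)) p.2

/-- Euclidean norm of the gradient `|∇u|`. -/
noncomputable def gradNorm (u : ℝ × ℝ → ℝ) (p : ℝ × ℝ) : ℝ :=
  Real.sqrt ((pdx u p) ^ 2 + (pdy u p) ^ 2)

/-- The closed unit square `[0,1] × [0,1]`. -/
def SQ : Set (ℝ × ℝ) := Icc (0 : ℝ) 1 ×ˢ Icc (0 : ℝ) 1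

/-- The open unit square `(0,1) × (0,1)`. -/
def SQo : Set (ℝ × ℝ) := Ioo (0 : ℝ) 1 ×ˢ Ioo (0 : ℝ) 1

/-- `v` is continuously differentiable on an open neighborhood of the closed unit square. -/
def C1Nbhd (v : ℝ × ℝ → ℝ) : Prop :=
  ∃ W : Set (ℝ × ℝ), IsOpen W ∧ SQ ⊆ W ∧ ContDiffOn ℝ 1 v W

/-- A classical solution `(u, (U₀, U₁))` of the Complete Electrode Model on the unit square
for the conductivity `σ`, constant impedances `z₀, z₁` (bottom/top electrodes) and
input currents `I₀, I₁`. -/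
structure IsCEMSolution (σ u : ℝ × ℝ → ℝ) (U₀ U₁ z₀ z₁ I₀ I₁ : ℝ) : Prop where
  smooth : ∃ W : Set (ℝ × ℝ), IsOpen W ∧ SQ ⊆ W ∧ ContDiffOn ℝ 2 u W
  ground : U₀ + U₁ = 0
  pde : ∀ p ∈ SQo,
    pdx (fun q => σ q * pdx u q) p + pdy (fun q => σ q * pdy u q) p = 0
  robin_bot : ∀ x ∈ Icc (0 : ℝ) 1, u (x, 0) - z₀ * σ (x, 0) * pdy u (x, 0) = U₀
  robin_top : ∀ x ∈ Icc (0 : ℝ) 1, u (x, 1) + z₁ * σ (x, 1) * pdy u (x, 1) = U₁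
  flux_bot : (∫ x in (0 : ℝ)..1, -(σ (x, 0) * pdy u (x, 0))) = I₀
  flux_top : (∫ x in (0 : ℝ)..1, σ (x, 1) * pdy u (x, 1)) = I₁
  noflux_left : ∀ y ∈ Icc (0 : ℝ) 1, pdx u (0, y) = 0
  noflux_right : ∀ y ∈ Icc (0 : ℝ) 1, pdx u (1, y) = 0

/-- The weighted least-gradient functional `G_a` with CEM boundary terms. -/
noncomputable def Gfun (a : ℝ × ℝ → ℝ) (z₀ z₁ I₀ I₁ : ℝ) (v : ℝ × ℝ → ℝ)
    (V₀ V₁ : ℝ) : ℝ :=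
  (∫ p in SQo, a p * gradNorm v p)
    + (1 / (2 * z₀)) * (∫ x in (0 : ℝ)..1, (v (x, 0) - V₀) ^ 2)
    + (1 / (2 * z₁)) * (∫ x in (0 : ℝ)..1, (v (x, 1) - V₁) ^ 2)
    - I₀ * V₀ - I₁ * V₁

/-- The CEM energy functional `F_σ`. -/
noncomputable def Ffun (σ : ℝ × ℝ → ℝ) (z₀ z₁ I₀ I₁ : ℝ) (v : ℝ × ℝ → ℝ)
    (V₀ V₁ : ℝ) : ℝ :=
  (1 / 2) * (∫ p in SQo, σ p * ((pdx v p) ^ 2 + (pdy v p) ^ 2))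
    + (1 / (2 * z₀)) * (∫ x in (0 : ℝ)..1, (v (x, 0) - V₀) ^ 2)
    + (1 / (2 * z₁)) * (∫ x in (0 : ℝ)..1, (v (x, 1) - V₁) ^ 2)
    - I₀ * V₀ - I₁ * V₁

lemma pdx_eq_fderiv {u : ℝ × ℝ → ℝ} {p : ℝ × ℝ} (h : DifferentiableAt ℝ u p) :
    pdx u p = fderiv ℝ u p (1, 0) := by
  have hline : HasDerivAt (fun t : ℝ => (t, p.2)) ((1 : ℝ), (0 : ℝ)) p.1 :=
    (hasDerivAt_id p.1).prodMk (hasDerivAt_const p.1 p.2)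
  exact (h.hasFDerivAt.comp_hasDerivAt (f := fun t : ℝ => (t, p.2)) p.1 hline).deriv

lemma pdy_eq_fderiv {u : ℝ × ℝ → ℝ} {p : ℝ × ℝ} (h : DifferentiableAt ℝ u p) :
    pdy u p = fderiv ℝ u p (0, 1) := by
  have hline : HasDerivAt (fun t : ℝ => (p.1, t)) ((0 : ℝ), (1 : ℝ)) p.2 :=
    (hasDerivAt_const p.2 p.1).prodMk (hasDerivAt_id p.2)
  exact (h.hasFDerivAt.comp_hasDerivAt (f := fun t : ℝ => (p.1, t)) p.2 hline).deriv

lemma pdx_sub {f g : ℝ × ℝ → ℝ} {p : ℝ × ℝ}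
    (hf : DifferentiableAt ℝ f p) (hg : DifferentiableAt ℝ g p) :
    pdx (fun q => f q - g q) p = pdx f p - pdx g p := by
  rw [pdx_eq_fderiv (hf.fun_sub hg), pdx_eq_fderiv hf, pdx_eq_fderiv hg,
    fderiv_fun_sub hf hg]
  rfl

lemma pdx_mul_sub {w f g : ℝ × ℝ → ℝ} {p : ℝ × ℝ} (hw : DifferentiableAt ℝ w p)
    (hf : DifferentiableAt ℝ f p) (hg : DifferentiableAt ℝ g p) :
    pdx (fun q => w q * (f q - g q)) p
      = pdx w p * (f p - g p) + w p * (pdx f p - pdx g p) := by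
  rw [pdx_eq_fderiv (hw.fun_mul (hf.fun_sub hg)), pdx_eq_fderiv hw, pdx_eq_fderiv hf,
    pdx_eq_fderiv hg, fderiv_fun_mul hw (hf.fun_sub hg), fderiv_fun_sub hf hg]
  simp
  ring

lemma pdy_sub {f g : ℝ × ℝ → ℝ} {p : ℝ × ℝ}
    (hf : DifferentiableAt ℝ f p) (hg : DifferentiableAt ℝ g p) :
    pdy (fun q => f q - g q) p = pdy f p - pdy g p := by
  rw [pdy_eq_fderiv (hf.fun_sub hg), pdy_eq_fderiv hf, pdy_eq_fderiv hg,
    fderiv_fun_sub hf hg]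
  rfl

lemma pdy_mul_sub {w f g : ℝ × ℝ → ℝ} {p : ℝ × ℝ} (hw : DifferentiableAt ℝ w p)
    (hf : DifferentiableAt ℝ f p) (hg : DifferentiableAt ℝ g p) :
    pdy (fun q => w q * (f q - g q)) p
      = pdy w p * (f p - g p) + w p * (pdy f p - pdy g p) := by
  rw [pdy_eq_fderiv (hw.fun_mul (hf.fun_sub hg)), pdy_eq_fderiv hw, pdy_eq_fderiv hf,
    pdy_eq_fderiv hg, fderiv_fun_mul hw (hf.fun_sub hg), fderiv_fun_sub hf hg]
  simp
  ring

lemma ContDiffOn.differentiableAt_of_isOpen {u : ℝ × ℝ → ℝ} {W : Set (ℝ × ℝ)}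
    (hW : IsOpen W) (hu : ContDiffOn ℝ 1 u W) {p : ℝ × ℝ} (hp : p ∈ W) :
    DifferentiableAt ℝ u p :=
  (hu.contDiffAt (hW.mem_nhds hp)).differentiableAt one_ne_zero

lemma contDiffOn_pdx {u : ℝ × ℝ → ℝ} {W : Set (ℝ × ℝ)} (hW : IsOpen W)
    (hu : ContDiffOn ℝ 2 u W) : ContDiffOn ℝ 1 (pdx u) W :=
  ((hu.fderiv_of_isOpen hW (m := 1) (by norm_num)).clm_apply contDiffOn_const).congr
    fun _ hp => pdx_eq_fderiv ((hu.of_le one_le_two).differentiableAt_of_isOpen hW hp)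

lemma contDiffOn_pdy {u : ℝ × ℝ → ℝ} {W : Set (ℝ × ℝ)} (hW : IsOpen W)
    (hu : ContDiffOn ℝ 2 u W) : ContDiffOn ℝ 1 (pdy u) W :=
  ((hu.fderiv_of_isOpen hW (m := 1) (by norm_num)).clm_apply contDiffOn_const).congr
    fun _ hp => pdy_eq_fderiv ((hu.of_le one_le_two).differentiableAt_of_isOpen hW hp)

lemma SQ_eq_Icc : SQ = Icc ((0 : ℝ), (0 : ℝ)) (1, 1) := Icc_prod_Icc _ _ _ _

lemma SQo_subset_SQ : SQo ⊆ SQ := prod_mono Ioo_subset_Icc_self Ioo_subset_Icc_self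

lemma closure_SQo : closure SQo = SQ := by
  simp [SQo, SQ, closure_prod_eq]

/-- The outward flux through the boundary of the unit square of a vector field `(P, Q)` with
nonnegative divergence is nonnegative. -/
lemma boundary_flux_nonneg {P Q : ℝ × ℝ → ℝ} {W : Set (ℝ × ℝ)} (hW : IsOpen W) (hSW : SQ ⊆ W)
    (hP : ContDiffOn ℝ 1 P W) (hQ : ContDiffOn ℝ 1 Q W)
    (hdiv : ∀ p ∈ SQo, 0 ≤ pdx P p + pdy Q p) :
    0 ≤ (∫ x in (0 : ℝ)..1, Q (x, 1)) - (∫ x in (0 : ℝ)..1, Q (x, 0))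
      + (∫ y in (0 : ℝ)..1, P (1, y)) - ∫ y in (0 : ℝ)..1, P (0, y) := by
  have hcont : ContinuousOn (fun p => fderiv ℝ P p (1, 0) + fderiv ℝ Q p (0, 1)) SQ :=
    (((hP.continuousOn_fderiv_of_isOpen hW le_rfl).clm_apply continuousOn_const).add
      ((hQ.continuousOn_fderiv_of_isOpen hW le_rfl).clm_apply continuousOn_const)).mono hSW
  have hdP : ∀ p ∈ SQ, DifferentiableAt ℝ P p := fun p hp =>
    hP.differentiableAt_of_isOpen hW (hSW hp)
  have hdQ : ∀ p ∈ SQ, DifferentiableAt ℝ Q p := fun p hp =>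
    hQ.differentiableAt_of_isOpen hW (hSW hp)
  have hnonneg : ∀ p ∈ SQ, 0 ≤ fderiv ℝ P p (1, 0) + fderiv ℝ Q p (0, 1) := by
    intro p hp
    rw [← closure_SQo] at hcont hp
    refine closure_minimal ?_ isClosed_Ici (hcont.image_closure (mem_image_of_mem _ hp))
    rintro _ ⟨q, hq, rfl⟩
    have h := hdiv q hq
    rwa [pdx_eq_fderiv (hdP q (SQo_subset_SQ hq)),
      pdy_eq_fderiv (hdQ q (SQo_subset_SQ hq))] at h
  have hcompact : IsCompact SQ := isCompact_Icc.prod isCompact_Icc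
  have hmeas : MeasurableSet SQ := measurableSet_Icc.prod measurableSet_Icc
  have key := integral_divergence_prod_Icc_of_hasFDerivAt_of_le P Q (fderiv ℝ P) (fderiv ℝ Q)
    (0, 0) (1, 1) (by simp [Prod.mk_le_mk])
    (SQ_eq_Icc ▸ hP.continuousOn.mono hSW) (SQ_eq_Icc ▸ hQ.continuousOn.mono hSW)
    (fun p hp => (hdP p (SQo_subset_SQ hp)).hasFDerivAt)
    (fun p hp => (hdQ p (SQo_subset_SQ hp)).hasFDerivAt)
    (SQ_eq_Icc ▸ hcont.integrableOn_compact hcompact)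
  rw [← SQ_eq_Icc] at key
  rw [← key]
  exact setIntegral_nonneg hmeas hnonneg

lemma integral_mul_add_const_mul {g : ℝ → ℝ} (hg : ContinuousOn g (Icc 0 1))
    (hg0 : ∫ x in (0 : ℝ)..1, g x = 0) (z c : ℝ) :
    ∫ x in (0 : ℝ)..1, (z * g x + c) * g x = z * ∫ x in (0 : ℝ)..1, g x ^ 2 := by
  have hgi := hg.intervalIntegrable_of_Icc (μ := volume) zero_le_one
  have hgi2 := (hg.fun_pow 2).intervalIntegrable_of_Icc (μ := volume) zero_le_one
  calc ∫ x in (0 : ℝ)..1, (z * g x + c) * g x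
      = ∫ x in (0 : ℝ)..1, (z * g x ^ 2 + c * g x) := by
        congr 1; ext x; ring
    _ = z * ∫ x in (0 : ℝ)..1, g x ^ 2 := by
        rw [intervalIntegral.integral_add (hgi2.const_mul z) (hgi.const_mul c),
          intervalIntegral.integral_const_mul, intervalIntegral.integral_const_mul, hg0,
          mul_zero, add_zero]

lemma eq_zero_of_integral_sq_nonpos {g : ℝ → ℝ} (hg : ContinuousOn g (Icc 0 1))
    (h : ∫ x in (0 : ℝ)..1, g x ^ 2 ≤ 0) : ∀ x ∈ Icc (0 : ℝ) 1, g x = 0 := by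
  by_contra! hne
  obtain ⟨c, hc, hgc⟩ := hne
  refine h.not_gt ?_
  simpa using intervalIntegral.integral_lt_integral_of_continuousOn_of_le_of_exists_lt
    (f := fun _ => (0 : ℝ)) zero_lt_one continuousOn_const (hg.pow 2)
    (fun x _ => sq_nonneg (g x)) ⟨c, hc, sq_pos_of_ne_zero hgc⟩

/-- Monotonicity of the map sending a gradient to a current of prescribed magnitude. -/
lemma currents_monotone {s t a b c d : ℝ} (hs : 0 < s) (ht : 0 < t)
    (h : s * √(a ^ 2 + b ^ 2) = t * √(c ^ 2 + d ^ 2)) :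
    0 ≤ (a - c) * (s * a - t * c) + (b - d) * (s * b - t * d) := by
  have hsq : s ^ 2 * (a ^ 2 + b ^ 2) = t ^ 2 * (c ^ 2 + d ^ 2) := by
    have := congrArg (· ^ 2) h
    simpa only [mul_pow, Real.sq_sqrt (add_nonneg (sq_nonneg _) (sq_nonneg _))] using this
  have heq : (a - c) * (s * a - t * c) + (b - d) * (s * b - t * d)
      = (s + t) / (2 * (s * t)) * ((s * a - t * c) ^ 2 + (s * b - t * d) ^ 2) := by
    field_simp
    linear_combination (t - s) * hsq
  rw [heq]
  positivity

/-- If two CEM solutions (for possibly different conductivities but the same electrode data)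
produce the same positive interior current magnitude, then the boundary potentials relative
to the electrode voltages agree on the electrodes. -/
theorem boundary_potentials_agree_on_electrodes
    (σ σt u v : ℝ × ℝ → ℝ) (U₀ U₁ V₀ V₁ z₀ z₁ I₀ I₁ : ℝ)
    (hσ : ∃ W : Set (ℝ × ℝ), IsOpen W ∧ SQ ⊆ W ∧ ContDiffOn ℝ 1 σ W)
    (hσt : ∃ W : Set (ℝ × ℝ), IsOpen W ∧ SQ ⊆ W ∧ ContDiffOn ℝ 1 σt W)
    (hσpos : ∀ p ∈ SQ, 0 < σ p) (hσtpos : ∀ p ∈ SQ, 0 < σt p)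
    (hz₀ : 0 < z₀) (hz₁ : 0 < z₁) (hI : I₀ + I₁ = 0)
    (hu : IsCEMSolution σ u U₀ U₁ z₀ z₁ I₀ I₁)
    (hv : IsCEMSolution σt v V₀ V₁ z₀ z₁ I₀ I₁)
    (hmag : ∀ p ∈ SQ, σ p * gradNorm u p = σt p * gradNorm v p)
    (hpos : ∀ p ∈ SQ, 0 < σ p * gradNorm u p) :
    ∀ x ∈ Icc (0 : ℝ) 1,
      u (x, 0) - U₀ = v (x, 0) - V₀ ∧ u (x, 1) - U₁ = v (x, 1) - V₁ := by
  obtain ⟨W₁, hW₁, hS₁, hσW⟩ := hσ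
  obtain ⟨W₂, hW₂, hS₂, hσtW⟩ := hσt
  obtain ⟨W₃, hW₃, hS₃, huW⟩ := hu.smooth
  obtain ⟨W₄, hW₄, hS₄, hvW⟩ := hv.smooth
  obtain ⟨W, hW, hSW, hσW, hσtW, huW, hvW⟩ : ∃ W : Set (ℝ × ℝ), IsOpen W ∧ SQ ⊆ W ∧
      ContDiffOn ℝ 1 σ W ∧ ContDiffOn ℝ 1 σt W ∧ ContDiffOn ℝ 2 u W ∧ ContDiffOn ℝ 2 v W :=
    ⟨W₁ ∩ W₂ ∩ (W₃ ∩ W₄), (hW₁.inter hW₂).inter (hW₃.inter hW₄),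
      subset_inter (subset_inter hS₁ hS₂) (subset_inter hS₃ hS₄),
      hσW.mono fun _ h => h.1.1, hσtW.mono fun _ h => h.1.2,
      huW.mono fun _ h => h.2.1, hvW.mono fun _ h => h.2.2⟩
  have hu1 := huW.of_le one_le_two
  have hv1 := hvW.of_le one_le_two
  have hJx := hσW.mul (contDiffOn_pdx hW huW)
  have hJy := hσW.mul (contDiffOn_pdy hW huW)
  have hKx := hσtW.mul (contDiffOn_pdx hW hvW)
  have hKy := hσtW.mul (contDiffOn_pdy hW hvW)
  have hflux := boundary_flux_nonneg hW hSW
    (P := fun q => (u q - v q) * (σ q * pdx u q - σt q * pdx v q))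
    (Q := fun q => (u q - v q) * (σ q * pdy u q - σt q * pdy v q))
    ((hu1.sub hv1).mul (hJx.sub hKx)) ((hu1.sub hv1).mul (hJy.sub hKy)) (by
      intro p hp
      have hpW := hSW (SQo_subset_SQ hp)
      have hdu := hu1.differentiableAt_of_isOpen hW hpW
      have hdv := hv1.differentiableAt_of_isOpen hW hpW
      rw [pdx_mul_sub (w := fun q => u q - v q) (f := fun q => σ q * pdx u q)
          (g := fun q => σt q * pdx v q) (hdu.fun_sub hdv)
          (hJx.differentiableAt_of_isOpen hW hpW) (hKx.differentiableAt_of_isOpen hW hpW),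
        pdy_mul_sub (w := fun q => u q - v q) (f := fun q => σ q * pdy u q)
          (g := fun q => σt q * pdy v q) (hdu.fun_sub hdv)
          (hJy.differentiableAt_of_isOpen hW hpW) (hKy.differentiableAt_of_isOpen hW hpW),
        pdx_sub hdu hdv, pdy_sub hdu hdv]
      have hmono := currents_monotone (hσpos p (SQo_subset_SQ hp)) (hσtpos p (SQo_subset_SQ hp))
        (hmag p (SQo_subset_SQ hp))
      linear_combination hmono + (u p - v p) * (hv.pde p hp - hu.pde p hp))
  have hleft : ∫ y in (0 : ℝ)..1,
      (u (0, y) - v (0, y)) * (σ (0, y) * pdx u (0, y) - σt (0, y) * pdx v (0, y)) = 0 := by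
    refine intervalIntegral.integral_zero_ae (.of_forall fun y hy => ?_)
    rw [uIoc_of_le zero_le_one] at hy
    simp [hu.noflux_left y (Ioc_subset_Icc_self hy), hv.noflux_left y (Ioc_subset_Icc_self hy)]
  have hright : ∫ y in (0 : ℝ)..1,
      (u (1, y) - v (1, y)) * (σ (1, y) * pdx u (1, y) - σt (1, y) * pdx v (1, y)) = 0 := by
    refine intervalIntegral.integral_zero_ae (.of_forall fun y hy => ?_)
    rw [uIoc_of_le zero_le_one] at hy
    simp [hu.noflux_right y (Ioc_subset_Icc_self hy), hv.noflux_right y (Ioc_subset_Icc_self hy)]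
  have hedge : ∀ y ∈ Icc (0 : ℝ) 1, MapsTo (fun x : ℝ => (x, y)) (Icc 0 1) W :=
    fun y hy x hx => hSW ⟨hx, hy⟩
  have hcJ : ∀ y ∈ Icc (0 : ℝ) 1, ContinuousOn (fun x => σ (x, y) * pdy u (x, y)) (Icc 0 1) :=
    fun y hy => hJy.continuousOn.comp (by fun_prop) (hedge y hy)
  have hcK : ∀ y ∈ Icc (0 : ℝ) 1, ContinuousOn (fun x => σt (x, y) * pdy v (x, y)) (Icc 0 1) :=
    fun y hy => hKy.continuousOn.comp (by fun_prop) (hedge y hy)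
  set g : ℝ → ℝ → ℝ := fun y x => σ (x, y) * pdy u (x, y) - σt (x, y) * pdy v (x, y) with hg
  have h0 : (0 : ℝ) ∈ Icc (0 : ℝ) 1 := by simp
  have h1 : (1 : ℝ) ∈ Icc (0 : ℝ) 1 := by simp
  have hgc : ∀ y ∈ Icc (0 : ℝ) 1, ContinuousOn (g y) (Icc 0 1) :=
    fun y hy => (hcJ y hy).sub (hcK y hy)
  have hgint : ∀ y ∈ Icc (0 : ℝ) 1, ∫ x in (0 : ℝ)..1, g y x
      = (∫ x in (0 : ℝ)..1, σ (x, y) * pdy u (x, y))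
        - ∫ x in (0 : ℝ)..1, σt (x, y) * pdy v (x, y) := fun y hy =>
    intervalIntegral.integral_sub ((hcJ y hy).intervalIntegrable_of_Icc zero_le_one)
      ((hcK y hy).intervalIntegrable_of_Icc zero_le_one)
  have hgint0 : ∫ x in (0 : ℝ)..1, g 0 x = 0 := by
    have hu0 := hu.flux_bot
    have hv0 := hv.flux_bot
    rw [intervalIntegral.integral_neg] at hu0 hv0
    rw [hgint 0 h0]
    linarith
  have hgint1 : ∫ x in (0 : ℝ)..1, g 1 x = 0 := by
    rw [hgint 1 h1, hu.flux_top, hv.flux_top, sub_self]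
  have hbot : ∫ x in (0 : ℝ)..1, (u (x, 0) - v (x, 0)) * g 0 x
      = z₀ * ∫ x in (0 : ℝ)..1, g 0 x ^ 2 := by
    rw [← integral_mul_add_const_mul (hgc 0 h0) hgint0 z₀ (U₀ - V₀)]
    refine intervalIntegral.integral_congr fun x hx => ?_
    rw [uIcc_of_le zero_le_one] at hx
    simp only [hg]
    linear_combination (σ (x, 0) * pdy u (x, 0) - σt (x, 0) * pdy v (x, 0)) *
      (hu.robin_bot x hx - hv.robin_bot x hx)
  have htop : ∫ x in (0 : ℝ)..1, (u (x, 1) - v (x, 1)) * g 1 x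
      = -z₁ * ∫ x in (0 : ℝ)..1, g 1 x ^ 2 := by
    rw [← integral_mul_add_const_mul (hgc 1 h1) hgint1 (-z₁) (U₁ - V₁)]
    refine intervalIntegral.integral_congr fun x hx => ?_
    rw [uIcc_of_le zero_le_one] at hx
    simp only [hg]
    linear_combination (σ (x, 1) * pdy u (x, 1) - σt (x, 1) * pdy v (x, 1)) *
      (hu.robin_top x hx - hv.robin_top x hx)
  have hsum : z₁ * (∫ x in (0 : ℝ)..1, g 1 x ^ 2) + z₀ * (∫ x in (0 : ℝ)..1, g 0 x ^ 2) ≤ 0 := by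
    simp only [hg] at hbot htop ⊢
    rw [hleft, hright, hbot, htop] at hflux
    linarith
  have hsq : ∀ y, 0 ≤ ∫ x in (0 : ℝ)..1, g y x ^ 2 := fun y =>
    intervalIntegral.integral_nonneg zero_le_one fun x _ => sq_nonneg _
  have hg0 := eq_zero_of_integral_sq_nonpos (hgc 0 h0)
    (nonpos_of_mul_nonpos_right (by nlinarith [hsq 1]) hz₀)
  have hg1 := eq_zero_of_integral_sq_nonpos (hgc 1 h1)
    (nonpos_of_mul_nonpos_right (by nlinarith [hsq 0]) hz₁)
  intro x hx
  constructor
  · linear_combination hu.robin_bot x hx - hv.robin_bot x hx + z₀ * hg0 x hx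
  · linear_combination hu.robin_top x hx - hv.robin_top x hx - z₁ * hg1 x hx
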